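/- Let X be a Hausdorff topological space. Then X is completely normal if and only if for every closed subset A ⊆ X and every upper semicontinuous set-valued map T : A → [0,1] with nonempty closed convex values, there exists an upper semicontinuous set-valued map T̃ : X → [0,1] with nonempty closed convex values such that T̃(a) = T(a) for every a ∈ A. -/

import Mathlib

/-- A set-valued map `T` is upper semicontinuous at `x₀`. -/
def SetValuedUscAt {X : Type*} [TopologicalSpace X] (T : X → Set ℝ) (x₀ : X) : Prop :=
  ∀ V : Set ℝ, IsOpen V → T x₀ ⊆ V → ∃ U : Set X, IsOpen U ∧ x₀ ∈ U ∧ ∀ x ∈ U, T x ⊆ V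

/-- A set-valued map is upper semicontinuous if it is so at every point. -/
def SetValuedUsc {X : Type*} [TopologicalSpace X] (T : X → Set ℝ) : Prop :=
  ∀ x, SetValuedUscAt T x

open Set

section

variable {X : Type*} [TopologicalSpace X]

theorem SetValuedUsc.isOpen_setOf_subset {T : X → Set ℝ} (hT : SetValuedUsc T) {V : Set ℝ}
    (hV : IsOpen V) : IsOpen {x | T x ⊆ V} := by
  refine isOpen_iff_forall_mem_open.2 fun x hx => ?_
  obtain ⟨U, hU, hxU, h⟩ := hT x V hV hx
  exact ⟨U, h, hU, hxU⟩

/-- Imposing closed constraints on a compact set, each of them over an open set of parameters,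
gives an upper semicontinuous map. -/
theorem setValuedUsc_of_isOpen_of_isClosed {ι : Type*} {K : Set ℝ} (hK : IsCompact K)
    {W : ι → Set X} (hW : ∀ i, IsOpen (W i)) {C : ι → Set ℝ} (hC : ∀ i, IsClosed (C i)) :
    SetValuedUsc fun x => {t ∈ K | ∀ i, x ∈ W i → t ∈ C i} := by
  intro x V hV hxV
  obtain ⟨u, hu⟩ := (hK.diff hV).elim_finite_subfamily_closed
    (fun i : {i // x ∈ W i} => C i) (fun i => hC i) (by
      refine eq_empty_of_forall_notMem fun t ht => ht.1.2 (hxV ⟨ht.1.1, fun i hi => ?_⟩)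
      exact mem_iInter.1 ht.2 ⟨i, hi⟩)
  refine ⟨⋂ i ∈ u, W i, isOpen_biInter_finset fun i _ => hW i,
    mem_iInter₂.2 fun i _ => i.2, fun y hy t ht => ?_⟩
  by_contra htV
  refine (eq_empty_iff_forall_notMem.1 hu) t ⟨⟨ht.1, htV⟩, mem_iInter₂.2 fun i hi => ?_⟩
  exact ht.2 i (mem_iInter₂.1 hy i hi)

theorem isClosed_sep_forall {ι : Type*} {K : Set ℝ} (hK : IsClosed K) {C : ι → Set ℝ}
    (hC : ∀ i, IsClosed (C i)) (p : ι → Prop) : IsClosed {t ∈ K | ∀ i, p i → t ∈ C i} := by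
  convert hK.inter (isClosed_iInter fun i => isClosed_iInter fun _ : p i => hC i)
  ext t
  simp

theorem convex_sep_forall {ι : Type*} {K : Set ℝ} (hK : Convex ℝ K) {C : ι → Set ℝ}
    (hC : ∀ i, Convex ℝ (C i)) (p : ι → Prop) : Convex ℝ {t ∈ K | ∀ i, p i → t ∈ C i} := by
  convert hK.inter (convex_iInter fun i => convex_iInter fun _ : p i => hC i)
  ext t
  simp

theorem IsClosed.separatedNhds_image_val [CompletelyNormalSpace X] {A : Set X} (hA : IsClosed A)
    {U V : Set A} (hU : IsOpen U) (hV : IsOpen V) (h : Disjoint U V) :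
    SeparatedNhds ((↑) '' U : Set X) ((↑) '' V) := by
  have key : ∀ {U V : Set A}, IsOpen V → Disjoint U V →
      Disjoint (closure ((↑) '' U : Set X)) ((↑) '' V) := by
    intro U V hV h
    rw [hA.isClosedEmbedding_subtypeVal.closure_image_eq]
    exact (disjoint_image_iff Subtype.val_injective).2 (h.closure_left hV)
  exact separatedNhds_iff_disjoint.2 (completely_normal (key hV h) (key hU h.symm).symm)

/-- A monotone and an antitone countable family of open sets of a closed subspace, disjoint at each index,
extend to families of open sets of the whole space with the same disjointness relations. -/
theorem IsClosed.exists_isOpen_extension_disjoint [CompletelyNormalSpace X] {A : Set X}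
    (hA : IsClosed A) {ι : Type*} [LinearOrder ι] [Countable ι] {U V : ι → Set A}
    (hUo : ∀ i, IsOpen (U i)) (hVo : ∀ i, IsOpen (V i)) (hU : Monotone U) (hV : Antitone V)
    (hUV : ∀ i, Disjoint (U i) (V i)) :
    ∃ G H : ι → Set X, (∀ i, IsOpen (G i)) ∧ (∀ i, IsOpen (H i)) ∧
      (∀ i, ((↑) ⁻¹' G i : Set A) = U i) ∧ (∀ i, ((↑) ⁻¹' H i : Set A) = V i) ∧
      ∀ i j, i ≤ j → Disjoint (G i) (H j) := by
  obtain ⟨e, he⟩ := exists_injective_nat ι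
  choose O hO hOU using fun i => isOpen_induced_iff.1 (hUo i)
  choose O' hO' hOV using fun i => isOpen_induced_iff.1 (hVo i)
  choose P Q hP hQ hUP hVQ hPQ using fun i =>
    hA.separatedNhds_image_val (hUo i) (hVo i) (hUV i)
  have hfin : ∀ (p : ι → Prop) (i : ι), {j | p j ∧ e j ≤ e i}.Finite := fun p i =>
    ((finite_Iic (e i)).preimage he.injOn).subset fun j hj => hj.2
  have hUQ : ∀ i j, i ≤ j → ∀ a ∈ U i, (a : X) ∉ closure (Q j) := fun i j hij a ha =>
    disjoint_left.1 ((hPQ j).closure_right (hP j)) (hUP j ⟨a, hU hij ha, rfl⟩)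
  have hVP : ∀ i j, j ≤ i → ∀ a ∈ V i, (a : X) ∉ closure (P j) := fun i j hij a ha =>
    disjoint_right.1 ((hPQ j).closure_left (hQ j)) (hVQ j ⟨a, hV hij ha, rfl⟩)
  refine ⟨fun i => (O i ∩ P i) \ ⋃ j ∈ {j | i ≤ j ∧ e j ≤ e i}, closure (Q j),
    fun i => (O' i ∩ Q i) \ ⋃ j ∈ {j | j ≤ i ∧ e j ≤ e i}, closure (P j),
    fun i => ((hO i).inter (hP i)).sdiff ((hfin _ i).isClosed_biUnion fun _ _ => isClosed_closure),
    fun i => ((hO' i).inter (hQ i)).sdiff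
      ((hfin _ i).isClosed_biUnion fun _ _ => isClosed_closure),
    fun i => ?_, fun i => ?_, fun i j hij => ?_⟩
  · refine Subset.antisymm (fun a ha => (hOU i).le ha.1.1) fun a ha => ?_
    refine ⟨⟨(hOU i).ge ha, hUP i ⟨a, ha, rfl⟩⟩, fun h => ?_⟩
    obtain ⟨j, hj, haj⟩ := mem_iUnion₂.1 h
    exact hUQ i j hj.1 a ha haj
  · refine Subset.antisymm (fun a ha => (hOV i).le ha.1.1) fun a ha => ?_
    refine ⟨⟨(hOV i).ge ha, hVQ i ⟨a, ha, rfl⟩⟩, fun h => ?_⟩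
    obtain ⟨j, hj, haj⟩ := mem_iUnion₂.1 h
    exact hVP i j hj.1 a ha haj
  · refine disjoint_left.2 fun x hx hx' => ?_
    rcases le_total (e i) (e j) with h | h
    · exact hx'.2 (mem_iUnion₂.2 ⟨i, ⟨hij, h⟩, subset_closure hx.1.2⟩)
    · exact hx.2 (mem_iUnion₂.2 ⟨j, ⟨hij, h⟩, subset_closure hx'.1.2⟩)

/-- A nonempty closed convex subset of `[0, 1]` is cut out by the strict rational bounds
in `[0, 1]` that it satisfies. -/
theorem Convex.mem_of_forall_rat_bounds {S : Set ℝ} (hconv : Convex ℝ S) (hcl : IsClosed S)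
    (hne : S.Nonempty) (hS : S ⊆ Icc 0 1) {t : ℝ} (ht : t ∈ Icc (0 : ℝ) 1)
    (hub : ∀ r : ℚ, (r : ℝ) ∈ Icc (0 : ℝ) 1 → S ⊆ Iio (r : ℝ) → t ≤ r)
    (hlb : ∀ r : ℚ, (r : ℝ) ∈ Icc (0 : ℝ) 1 → S ⊆ Ioi (r : ℝ) → (r : ℝ) ≤ t) : t ∈ S := by
  have hK : IsCompact S := isCompact_Icc.of_isClosed_subset hcl hS
  obtain ⟨m, hm, hmin⟩ := hK.exists_isLeast hne
  obtain ⟨M, hM, hmax⟩ := hK.exists_isGreatest hne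
  refine hconv.ordConnected.out hm hM ⟨?_, ?_⟩
  · by_contra! h
    obtain ⟨r, hr, hr'⟩ := exists_rat_btwn h
    exact hr.not_ge (hlb r ⟨ht.1.trans hr.le, hr'.le.trans (hS hm).2⟩
      fun y hy => hr'.trans_le (hmin hy))
  · by_contra! h
    obtain ⟨r, hr, hr'⟩ := exists_rat_btwn h
    exact hr'.not_ge (hub r ⟨(hS hM).1.trans hr.le, hr'.le.trans ht.2⟩
      fun y hy => (hmax hy).trans_lt hr)

theorem SetValuedUsc.exists_extension [CompletelyNormalSpace X] {A : Set X} (hA : IsClosed A)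
    {T : A → Set ℝ} (hT : SetValuedUsc T) (hT01 : ∀ a, T a ⊆ Icc (0 : ℝ) 1)
    (hne : ∀ a, (T a).Nonempty) (hcl : ∀ a, IsClosed (T a)) (hconv : ∀ a, Convex ℝ (T a)) :
    ∃ T' : X → Set ℝ, SetValuedUsc T' ∧ (∀ x, T' x ⊆ Icc (0 : ℝ) 1) ∧ (∀ x, (T' x).Nonempty) ∧
      (∀ x, IsClosed (T' x)) ∧ (∀ x, Convex ℝ (T' x)) ∧ ∀ a : A, T' (a : X) = T a := by
  let ι := {r : ℚ // (r : ℝ) ∈ Icc (0 : ℝ) 1}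
  obtain ⟨G, H, hG, hH, hGU, hHV, hGH⟩ := hA.exists_isOpen_extension_disjoint
    (ι := ι) (U := fun r => {a | T a ⊆ Iio (r.1 : ℝ)}) (V := fun r => {a | T a ⊆ Ioi (r.1 : ℝ)})
    (fun r => hT.isOpen_setOf_subset isOpen_Iio) (fun r => hT.isOpen_setOf_subset isOpen_Ioi)
    (fun r s hrs a ha => Subset.trans ha (Iio_subset_Iio (Rat.cast_le.2 hrs)))
    (fun r s hrs a ha => Subset.trans ha (Ioi_subset_Ioi (Rat.cast_le.2 hrs)))
    (fun r => disjoint_left.2 fun a ha ha' => by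
      obtain ⟨t, ht⟩ := hne a
      exact lt_asymm (mem_Iio.1 (ha ht)) (mem_Ioi.1 (ha' ht)))
  let W : ι ⊕ ι → Set X := Sum.elim G H
  let C : ι ⊕ ι → Set ℝ := Sum.elim (fun r => Iic (r.1 : ℝ)) (fun r => Ici (r.1 : ℝ))
  have hW : ∀ i, IsOpen (W i) := Sum.forall.2 ⟨hG, hH⟩
  have hC : ∀ i, IsClosed (C i) := Sum.forall.2 ⟨fun _ => isClosed_Iic, fun _ => isClosed_Ici⟩
  have hCc : ∀ i, Convex ℝ (C i) := Sum.forall.2 ⟨fun _ => convex_Iic _, fun _ => convex_Ici _⟩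
  refine ⟨fun x => {t ∈ Icc (0 : ℝ) 1 | ∀ i, x ∈ W i → t ∈ C i},
    setValuedUsc_of_isOpen_of_isClosed isCompact_Icc hW hC, fun x t ht => ht.1, fun x => ?_,
    fun x => isClosed_sep_forall isClosed_Icc hC _, fun x => convex_sep_forall (convex_Icc 0 1) hCc _,
    fun a => Subset.antisymm ?_ ?_⟩
  · let S : Set ℝ := insert 0 {t | ∃ s : ι, x ∈ H s ∧ (s.1 : ℝ) = t}
    have hS : ∀ u ∈ Icc (0 : ℝ) 1, (∀ s : ι, x ∈ H s → (s.1 : ℝ) ≤ u) → ∀ t ∈ S, t ≤ u := by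
      rintro u hu h t (rfl | ⟨s, hs, rfl⟩)
      exacts [hu.1, h s hs]
    have hSne : S.Nonempty := ⟨0, mem_insert _ _⟩
    have hS1 : ∀ t ∈ S, t ≤ 1 := hS 1 (by simp) fun s _ => s.2.2
    refine ⟨sSup S, ⟨le_csSup ⟨1, hS1⟩ (mem_insert _ _), csSup_le hSne hS1⟩,
      Sum.forall.2 ⟨fun r hr => ?_, fun s hs => ?_⟩⟩
    · refine csSup_le hSne (hS _ r.2 fun s hs => ?_)
      by_contra! h
      exact disjoint_left.1 (hGH r s (Rat.cast_le.1 h.le)) hr hs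
    · exact le_csSup ⟨1, hS1⟩ (mem_insert_of_mem _ ⟨s, hs, rfl⟩)
  · rintro t ⟨ht, h⟩
    refine (hconv a).mem_of_forall_rat_bounds (hcl a) (hne a) (hT01 a) ht
      (fun r hr hra => h (Sum.inl ⟨r, hr⟩) ?_) (fun r hr hra => h (Sum.inr ⟨r, hr⟩) ?_)
    · exact (hGU ⟨r, hr⟩).ge hra
    · exact (hHV ⟨r, hr⟩).ge hra
  · exact fun t ht => ⟨hT01 a ht, Sum.forall.2
      ⟨fun r hr => mem_Iic.2 (mem_Iio.1 ((hGU r).le hr ht)).le,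
        fun s hs => mem_Ici.2 (mem_Ioi.1 ((hHV s).le hs ht)).le⟩⟩

theorem SeparatedNhds.of_setValuedUsc {T : X → Set ℝ} (hT : SetValuedUsc T)
    (hne : ∀ x, (T x).Nonempty) {s t : Set X} (hs : ∀ x ∈ s, T x ⊆ {0})
    (ht : ∀ x ∈ t, T x ⊆ {1}) : SeparatedNhds s t := by
  refine ⟨{x | T x ⊆ Iio (1 / 2)}, {x | T x ⊆ Ioi (1 / 2)}, hT.isOpen_setOf_subset isOpen_Iio,
    hT.isOpen_setOf_subset isOpen_Ioi, fun x hx => (hs x hx).trans (by norm_num),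
    fun x hx => (ht x hx).trans (by norm_num), disjoint_left.2 fun x hx hx' => ?_⟩
  obtain ⟨y, hy⟩ := hne x
  exact lt_asymm (mem_Iio.1 (hx hy)) (mem_Ioi.1 (hx' hy))

end

/-- A Hausdorff space is completely normal iff every usc set-valued
map with nonempty closed convex values in `[0,1]` defined on a closed subset admits
a usc extension with nonempty closed convex values in `[0,1]` to the whole space. -/
theorem completelyNormal_iff_usc_extension
    {X : Type*} [TopologicalSpace X] [T2Space X] :
    CompletelyNormalSpace X ↔
      ∀ (A : Set X), IsClosed A → ∀ T : A → Set ℝ,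
        SetValuedUsc T →
        (∀ a, T a ⊆ Set.Icc (0 : ℝ) 1) →
        (∀ a, (T a).Nonempty) →
        (∀ a, IsClosed (T a)) →
        (∀ a, Convex ℝ (T a)) →
        ∃ T' : X → Set ℝ, SetValuedUsc T' ∧
          (∀ x, T' x ⊆ Set.Icc (0 : ℝ) 1) ∧
          (∀ x, (T' x).Nonempty) ∧
          (∀ x, IsClosed (T' x)) ∧
          (∀ x, Convex ℝ (T' x)) ∧
          (∀ a : A, T' (a : X) = T a) := by
  refine ⟨fun _ A hA T hT h01 hne hcl hconv => hT.exists_extension hA h01 hne hcl hconv,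
    fun h => ⟨fun s t hst hst' => ?_⟩⟩
  let W : Bool → Set ↥(closure s ∪ closure t) :=
    fun b => (↑) ⁻¹' (bif b then closure s else closure t)ᶜ
  let C : Bool → Set ℝ := fun b => bif b then {1} else {0}
  have hW : ∀ b, IsOpen (W b) := Bool.forall_bool.2
    ⟨isClosed_closure.isOpen_compl.preimage continuous_subtype_val,
      isClosed_closure.isOpen_compl.preimage continuous_subtype_val⟩
  have hC : ∀ b, IsClosed (C b) := Bool.forall_bool.2 ⟨isClosed_singleton, isClosed_singleton⟩
  have hCc : ∀ b, Convex ℝ (C b) := Bool.forall_bool.2 ⟨convex_singleton _, convex_singleton _⟩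
  obtain ⟨T', hT', -, hne, -, -, hext⟩ := h (closure s ∪ closure t)
    (isClosed_closure.union isClosed_closure)
    (fun x => {y ∈ Icc (0 : ℝ) 1 | ∀ b, x ∈ W b → y ∈ C b})
    (setValuedUsc_of_isOpen_of_isClosed isCompact_Icc hW hC) (fun x y hy => hy.1)
    (fun x => by
      by_cases hx : (x : X) ∈ closure s
      · exact ⟨0, by simp, Bool.forall_bool.2 ⟨fun _ => rfl, fun h => (h hx).elim⟩⟩
      · exact ⟨1, by simp, Bool.forall_bool.2
          ⟨fun h => (h (x.2.resolve_left hx)).elim, fun _ => rfl⟩⟩)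
    (fun x => isClosed_sep_forall isClosed_Icc hC _)
    (fun x => convex_sep_forall (convex_Icc 0 1) hCc _)
  refine separatedNhds_iff_disjoint.1 (.of_setValuedUsc hT' hne (fun x hx y hy => ?_)
    fun x hx y hy => ?_)
  · rw [hext ⟨x, Or.inl (subset_closure hx)⟩] at hy
    exact hy.2 false (disjoint_left.1 hst' hx)
  · rw [hext ⟨x, Or.inr (subset_closure hx)⟩] at hy
    exact hy.2 true (disjoint_right.1 hst hx)
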